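/- arXiv:1901.00130 — 2 statements merged into one kernel-verified Lean document; each statement's English description precedes it below -/
import Mathlib

section
/- Let d, L ∈ ℕ, R ≥ 1, c ≥ 1, and suppose each activation function σ_ℓ satisfies |σ_ℓ(t)| ≤ c(|t| + 1) for all t ∈ ℝ. For each ℓ = 1, …, L and every hidden-layer vector function h⃗_ℓ ∈ H⃗_ℓ produced by weight matrices and threshold vectors whose entries are bounded in absolute value by R, there holds ‖h⃗_ℓ‖_{*,d_ℓ} ≤ (c(1 + 2^{d+1}) R)^ℓ · d_{ℓ−1} ⋯ d_1 d_0. -/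
open MeasureTheory ENNReal

noncomputable section

/-- The cube `𝕀^d = [-1,1]^d` in Euclidean space. -/
def cube (d : ℕ) : Set (EuclideanSpace ℝ (Fin d)) := { x | ∀ i, |x i| ≤ 1 }

/-- Layer widths : `dimAt d dims 0 = d` (input dimension `d₀ = d`) and
`dimAt d dims k = dims k` for the hidden layers `k ≥ 1`. -/
def dimAt (d : ℕ) (dims : ℕ → ℕ) : ℕ → ℕ
  | 0 => d
  | k + 1 => dims (k + 1)

/-- The norm `‖h⃗_ℓ‖_{*,d_ℓ} = max_{1 ≤ i ≤ d_ℓ} ∫_{𝕀^d} |h_ℓ^i(x)| dx` of a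
vector-valued function on the cube. -/
def starNorm {d m : ℕ} (h : EuclideanSpace ℝ (Fin d) → Fin m → ℝ) : ℝ :=
  ⨆ i : Fin m, ∫ x in cube d, |h x i|

/-- `hiddenSet d dims σ R ℓ` is the set `H⃗_ℓ` of vectors of hidden-layer functions:
`H⃗_0 = {x ↦ x}` and `H⃗_{ℓ+1}` consists of all `x ↦ σ_{ℓ+1}(W h⃗_ℓ(x) + b)` with
`h⃗_ℓ ∈ H⃗_ℓ`, `W` a `d_{ℓ+1} × d_ℓ` matrix with entries bounded by `R` and `b ∈ ℝ^{d_{ℓ+1}}`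
with entries bounded by `R`. -/
def hiddenSet (d : ℕ) (dims : ℕ → ℕ) (σ : ℕ → ℝ → ℝ) (R : ℝ) :
    (ℓ : ℕ) → Set (EuclideanSpace ℝ (Fin d) → Fin (dimAt d dims ℓ) → ℝ)
  | 0 => { h | h = fun x i => x i }
  | ℓ + 1 =>
    { h | ∃ (W : Fin (dimAt d dims (ℓ + 1)) → Fin (dimAt d dims ℓ) → ℝ)
            (b : Fin (dimAt d dims (ℓ + 1)) → ℝ),
          (∀ i j, |W i j| ≤ R) ∧ (∀ i, |b i| ≤ R) ∧
          ∃ g ∈ hiddenSet d dims σ R ℓ,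
            h = fun x i => σ (ℓ + 1) ((∑ j, W i j * g x j) + b i) }

/-- `HasMajorant h I` says that every component of `h` is dominated in absolute value by an
integrable function whose integral over the cube is at most `I`. -/
def HasMajorant {d m : ℕ} (h : EuclideanSpace ℝ (Fin d) → Fin m → ℝ) (I : ℝ) : Prop :=
  ∃ B : Fin m → EuclideanSpace ℝ (Fin d) → ℝ,
    ∀ i, IntegrableOn (B i) (cube d) ∧ (∀ x, |h x i| ≤ B i x) ∧ ∫ x in cube d, B i x ≤ I

lemma HasMajorant.starNorm_le {d m : ℕ} {h : EuclideanSpace ℝ (Fin d) → Fin m → ℝ} {I : ℝ}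
    (hh : HasMajorant h I) (hI : 0 ≤ I) : starNorm h ≤ I := by
  obtain ⟨B, hB⟩ := hh
  refine Real.iSup_le (fun i => ?_) hI
  obtain ⟨hBint, hle, hbound⟩ := hB i
  exact (integral_mono_of_nonneg (Filter.Eventually.of_forall fun x => abs_nonneg _) hBint
    (Filter.Eventually.of_forall hle)).trans hbound

lemma HasMajorant.mono {d m : ℕ} {h : EuclideanSpace ℝ (Fin d) → Fin m → ℝ} {I J : ℝ}
    (hh : HasMajorant h I) (hIJ : I ≤ J) : HasMajorant h J := by
  obtain ⟨B, hB⟩ := hh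
  exact ⟨B, fun i => ⟨(hB i).1, (hB i).2.1, (hB i).2.2.trans hIJ⟩⟩

lemma cube_eq_preimage (d : ℕ) :
    cube d = (MeasurableEquiv.toLp 2 (Fin d → ℝ)).symm ⁻¹'
      (Set.univ.pi fun _ => Set.Icc (-1 : ℝ) 1) := by
  ext x
  simp only [cube, Set.mem_ofPred_eq, Set.mem_preimage, Set.mem_univ_pi, Set.mem_Icc, abs_le]
  rfl

lemma setIntegral_cube (d : ℕ) (f : (Fin d → ℝ) → ℝ) :
    ∫ x in cube d, f (WithLp.ofLp x) =
      ∫ y, f y ∂Measure.pi fun _ : Fin d => volume.restrict (Set.Icc (-1 : ℝ) 1) := by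
  rw [cube_eq_preimage, ← Measure.restrict_pi_pi, ← volume_pi]
  exact (EuclideanSpace.volume_preserving_symm_measurableEquiv_toLp
    (Fin d)).setIntegral_preimage_emb (MeasurableEquiv.measurableEmbedding _) f _

lemma volume_cube (d : ℕ) : volume (cube d) = 2 ^ d := by
  rw [cube_eq_preimage, (EuclideanSpace.volume_preserving_symm_measurableEquiv_toLp
    (Fin d)).measure_preimage_equiv, volume_pi_pi]
  norm_num

lemma isCompact_cube (d : ℕ) : IsCompact (cube d) := by
  have hc : cube d = (EuclideanSpace.equiv (Fin d) ℝ).toHomeomorph ⁻¹'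
      (Set.univ.pi fun _ => Set.Icc (-1 : ℝ) 1) := cube_eq_preimage d
  rw [hc, Homeomorph.isCompact_preimage]
  exact isCompact_univ_pi fun _ => isCompact_Icc

lemma integral_Icc_abs : ∫ t in Set.Icc (-1 : ℝ) 1, |t| = 1 := by
  rw [integral_Icc_eq_integral_Ioc, ← intervalIntegral.integral_of_le (by norm_num),
    ← intervalIntegral.integral_add_adjacent_intervals (b := 0)
      (continuous_abs.intervalIntegrable _ _) (continuous_abs.intervalIntegrable _ _),
    intervalIntegral.integral_congr (g := fun t : ℝ => -t) (a := -1),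
    intervalIntegral.integral_congr (g := fun t : ℝ => t) (a := 0)]
  · rw [intervalIntegral.integral_neg]
    norm_num
  · intro t ht
    rw [Set.uIcc_of_le (by norm_num)] at ht
    exact abs_of_nonneg ht.1
  · intro t ht
    rw [Set.uIcc_of_le (by norm_num)] at ht
    exact abs_of_nonpos ht.2

lemma setIntegral_cube_abs_coord {d : ℕ} (i : Fin d) :
    ∫ x in cube d, |x i| = 2 ^ (d - 1) := by
  have hprod : ∀ y : Fin d → ℝ, |y i| = ∏ j, if j = i then |y j| else 1 := by simp
  rw [setIntegral_cube d fun y => |y i|]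
  simp_rw [hprod]
  rw [integral_fintype_prod_eq_prod (fun j (t : ℝ) => if j = i then |t| else 1)]
  have hfactor : ∀ j, ∫ t in Set.Icc (-1 : ℝ) 1, (if j = i then |t| else 1) =
      if j = i then 1 else 2 := by
    intro j
    split_ifs
    · exact integral_Icc_abs
    · norm_num
  simp_rw [hfactor]
  rw [Finset.prod_ite]
  simp [Finset.filter_ne']

lemma hasMajorant_coord (d : ℕ) :
    HasMajorant (fun (x : EuclideanSpace ℝ (Fin d)) i => x i) (2 ^ (d - 1)) :=
  ⟨fun i x => |x i|, fun i =>
    ⟨ContinuousOn.integrableOn_compact (isCompact_cube d) (by fun_prop), fun _ => le_rfl,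
      (setIntegral_cube_abs_coord i).le⟩⟩

lemma HasMajorant.layer {d m n : ℕ} {g : EuclideanSpace ℝ (Fin d) → Fin n → ℝ} {I R c : ℝ}
    (hg : HasMajorant g I) (hR : 1 ≤ R) (hc : 1 ≤ c) {τ : ℝ → ℝ}
    (hτ : ∀ t, |τ t| ≤ c * (|t| + 1)) {W : Fin m → Fin n → ℝ} {b : Fin m → ℝ}
    (hW : ∀ i j, |W i j| ≤ R) (hb : ∀ i, |b i| ≤ R) :
    HasMajorant (fun x i => τ ((∑ j, W i j * g x j) + b i)) (c * R * (n * I + 2 ^ (d + 1))) := by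
  obtain ⟨B, hB⟩ := hg
  have hsum : IntegrableOn (fun x => ∑ j, B j x) (cube d) :=
    integrable_finsetSum _ fun j _ => (hB j).1
  have hconst : IntegrableOn (fun _ => (2 : ℝ)) (cube d) :=
    integrableOn_const (by simp [volume_cube])
  refine ⟨fun _ x => c * R * ((∑ j, B j x) + 2), fun i => ⟨(hsum.add hconst).const_mul _, ?_, ?_⟩⟩
  · intro x
    have habs : |(∑ j, W i j * g x j) + b i| ≤ R * (∑ j, B j x) + R := by
      refine (abs_add_le _ _).trans (add_le_add ?_ (hb i))
      rw [Finset.mul_sum]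
      refine (Finset.abs_sum_le_sum_abs _ _).trans (Finset.sum_le_sum fun j _ => ?_)
      rw [abs_mul]
      exact mul_le_mul (hW i j) ((hB j).2.1 x) (abs_nonneg _) (by linarith)
    calc |τ ((∑ j, W i j * g x j) + b i)|
        ≤ c * (|(∑ j, W i j * g x j) + b i| + 1) := hτ _
      _ ≤ c * (R * ((∑ j, B j x) + 2)) := by gcongr; linarith
      _ = c * R * ((∑ j, B j x) + 2) := by ring
  · have hvol : volume.real (cube d) = 2 ^ d := by simp [Measure.real, volume_cube]
    rw [integral_const_mul, integral_add hsum hconst, integral_finsetSum _ fun j _ => (hB j).1,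
      setIntegral_const, hvol, smul_eq_mul, ← pow_succ]
    have : ∑ j, ∫ x in cube d, B j x ≤ n * I := by
      simpa using Finset.sum_le_card_nsmul Finset.univ _ I fun j _ => (hB j).2.2
    gcongr

lemma mul_two_pow_add_le {d : ℕ} (hd : 1 ≤ d) :
    (d : ℝ) * 2 ^ (d - 1) + 2 ^ (d + 1) ≤ (1 + 2 ^ (d + 1)) * d := by
  obtain ⟨k, rfl⟩ := Nat.exists_eq_add_of_le' hd
  have hk : (0 : ℝ) ≤ k := k.cast_nonneg
  have hp : (0 : ℝ) ≤ k * 2 ^ k := by positivity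
  have hlt : (2 : ℝ) ^ k ≤ 1 + k + 3 * (k * 2 ^ k) := by
    rcases k with _ | k
    · simp
    · push_cast at hk hp ⊢
      nlinarith [mul_nonneg k.cast_nonneg (pow_nonneg (zero_le_two (α := ℝ)) (k + 1)),
        pow_nonneg (zero_le_two (α := ℝ)) (k + 1)]
  simp only [Nat.add_sub_cancel]
  push_cast
  rw [pow_succ, pow_succ]
  linarith

lemma dimAt_pos {d : ℕ} (hd : 1 ≤ d) {dims : ℕ → ℕ} (hdims : ∀ ℓ, 0 < dims ℓ) :
    ∀ ℓ, 0 < dimAt d dims ℓ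
  | 0 => hd
  | ℓ + 1 => hdims (ℓ + 1)

/-- The hidden layers satisfy the bound of the main theorem through an integrable majorant, which
makes the induction independent of the measurability of the activation functions. -/
lemma hasMajorant_of_mem_hiddenSet {d L : ℕ} (hd : 1 ≤ d) {dims : ℕ → ℕ}
    (hdims : ∀ ℓ, 0 < dims ℓ) {R c : ℝ} (hR : 1 ≤ R) (hc : 1 ≤ c) {σ : ℕ → ℝ → ℝ}
    (hgrow : ∀ k, 1 ≤ k → k ≤ L → ∀ t : ℝ, |σ k t| ≤ c * (|t| + 1)) {ℓ : ℕ} (hℓ : ℓ + 1 ≤ L)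
    {h : EuclideanSpace ℝ (Fin d) → Fin (dimAt d dims (ℓ + 1)) → ℝ}
    (hh : h ∈ hiddenSet d dims σ R (ℓ + 1)) :
    HasMajorant h ((c * (1 + 2 ^ (d + 1)) * R) ^ (ℓ + 1) *
      ∏ j ∈ Finset.range (ℓ + 1), (dimAt d dims j : ℝ)) := by
  have hcR : 0 ≤ c * R := by positivity
  induction ℓ with
  | zero =>
    obtain ⟨W, b, hW, hb, g, rfl, rfl⟩ := hh
    refine ((hasMajorant_coord d).layer hR hc (hgrow 1 le_rfl hℓ) hW hb).mono ?_
    calc c * R * (d * 2 ^ (d - 1) + 2 ^ (d + 1))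
        ≤ c * R * ((1 + 2 ^ (d + 1)) * d) :=
          mul_le_mul_of_nonneg_left (mul_two_pow_add_le hd) hcR
      _ = _ := by simp [dimAt]; ring
  | succ ℓ ih =>
    obtain ⟨W, b, hW, hb, g, hg, rfl⟩ := hh
    refine ((ih (by omega) hg).layer hR hc (hgrow (ℓ + 2) (by omega) hℓ) hW hb).mono ?_
    set P := (c * (1 + 2 ^ (d + 1)) * R) ^ (ℓ + 1) *
      ∏ j ∈ Finset.range (ℓ + 1), (dimAt d dims j : ℝ) with hP
    have hdim : ∀ j, (1 : ℝ) ≤ dimAt d dims j := fun j => by exact_mod_cast dimAt_pos hd hdims j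
    have hbase : 1 ≤ c * (1 + 2 ^ (d + 1)) * R :=
      one_le_mul_of_one_le_of_one_le
        (one_le_mul_of_one_le_of_one_le hc (le_add_of_nonneg_right (by positivity))) hR
    have hP1 : 1 ≤ P := one_le_mul_of_one_le_of_one_le (one_le_pow₀ hbase)
      (Finset.one_le_prod fun j _ => hdim j)
    have hnP : 1 ≤ dimAt d dims (ℓ + 1) * P := one_le_mul_of_one_le_of_one_le (hdim _) hP1
    calc c * R * (dimAt d dims (ℓ + 1) * P + 2 ^ (d + 1))
        ≤ c * R * ((1 + 2 ^ (d + 1)) * (dimAt d dims (ℓ + 1) * P)) := by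
          gcongr
          rw [add_mul, one_mul]
          gcongr
          exact le_mul_of_one_le_right (by positivity) hnP
      _ = _ := by rw [Finset.prod_range_succ, pow_succ, hP]; ring

/-- Lemma 1 of the paper: uniform bound for hidden layers. If each
activation satisfies `|σ_ℓ(t)| ≤ c(|t|+1)` with `c ≥ 1`, and all weights and
thresholds are bounded by `R ≥ 1`, then for `ℓ = 1,…,L`,
`‖h⃗_ℓ‖_{*,d_ℓ} ≤ (c(1+2^{d+1})R)^ℓ d_{ℓ-1} ⋯ d_1 d_0` for every `h⃗_ℓ ∈ H⃗_ℓ`. -/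
theorem stmt4 (d L : ℕ) (hd : 1 ≤ d) (dims : ℕ → ℕ) (hdims : ∀ ℓ, 0 < dims ℓ)
    (R c : ℝ) (hR : 1 ≤ R) (hc : 1 ≤ c) (σ : ℕ → ℝ → ℝ)
    (hgrow : ∀ k, 1 ≤ k → k ≤ L → ∀ t : ℝ, |σ k t| ≤ c * (|t| + 1)) :
    ∀ ℓ, 1 ≤ ℓ → ℓ ≤ L → ∀ h ∈ hiddenSet d dims σ R ℓ,
      starNorm h ≤
        (c * (1 + 2 ^ (d + 1)) * R) ^ ℓ *
          ∏ j ∈ Finset.range ℓ, ((dimAt d dims j : ℕ) : ℝ) := by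
  intro ℓ hℓ hℓL h hh
  obtain ⟨k, rfl⟩ := Nat.exists_eq_add_of_le' hℓ
  exact (hasMajorant_of_mem_hiddenSet hd hdims hR hc hgrow hℓL hh).starNorm_le (by positivity)

end
end

section
/- Let 1 ≤ p ≤ ∞, L ∈ ℕ, d, n ∈ ℕ with n ≥ 2, R ≥ 1 with R D_max ≥ 2, and let σ_1, …, σ_L satisfy the Lipschitz and linear-growth conditions with constants c, c_1 ≥ 1. Then there exists a constant C > 0 depending only on c, c_0, c_1, d, r and p such that dist(Lip^{(r,c_0)}, H_{n,L,σ,R}, L^p(𝕀^d)) ≥ C · [L² n log₂ n · log₂(R D_max)]^{−r/d}, where D_max := max_{0 ≤ ℓ ≤ L} d_ℓ; this follows from the L^1 lower bound combined with the inequality ‖f‖_{L^1(𝕀^d)} ≤ C_{d,p} ‖f‖_{L^p(𝕀^d)}. -/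
open MeasureTheory ENNReal

noncomputable section

/-- The `L¹(𝕀^d)` distance between two functions on the cube. -/
def L1dist {d : ℕ} (f g : EuclideanSpace ℝ (Fin d) → ℝ) : ℝ :=
  ∫ x in cube d, |f x - g x|

/-- `coverNum ρ ε V` is the `ε`-covering number of `V` with respect to the
distance `ρ` : the minimal number of elements of an `ε`-net for `V`. -/
def coverNum {α : Type*} (ρ : α → α → ℝ) (ε : ℝ) (V : Set α) : ℝ≥0∞ :=
  sInf { m : ℝ≥0∞ | ∃ T : Finset α, (T.card : ℝ≥0∞) = m ∧ ∀ v ∈ V, ∃ t ∈ T, ρ v t ≤ ε }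

/-- An entry of a weight matrix / threshold vector is either a prescribed fixed
real number (`Sum.inl`) or one of `n` shared free parameters (`Sum.inr`);
`paramEval θ` realizes it given the values `θ` of the free parameters. -/
def paramEval {n : ℕ} (θ : Fin n → ℝ) : ℝ ⊕ Fin n → ℝ := Sum.elim id θ

/-- A fixed network structure with (at most) `n` free parameters, `L` hidden layers,
input dimension `d` and widths `dims` : each entry of each weight matrix `W k`
(connecting layer `k` to layer `k+1`), of each threshold vector `b k` and of the
outer weight vector `a` is either a prescribed fixed constant or one of the `n`
shared free parameters. -/
structure NetStructure (n L d : ℕ) (dims : ℕ → ℕ) where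
  W : (k : ℕ) → Fin (dimAt d dims (k + 1)) → Fin (dimAt d dims k) → ℝ ⊕ Fin n
  b : (k : ℕ) → Fin (dimAt d dims (k + 1)) → ℝ ⊕ Fin n
  a : Fin (dimAt d dims L) → ℝ ⊕ Fin n

/-- The vector of hidden-layer functions `h_k` of the deep net:
`h_0(x) = x`, `h_{k+1}(x) = σ_{k+1}(W_{k+1} h_k(x) + b_{k+1})`. -/
def hiddenEval {n d : ℕ} {dims : ℕ → ℕ}
    (W : (k : ℕ) → Fin (dimAt d dims (k + 1)) → Fin (dimAt d dims k) → ℝ ⊕ Fin n)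
    (b : (k : ℕ) → Fin (dimAt d dims (k + 1)) → ℝ ⊕ Fin n)
    (σ : ℕ → ℝ → ℝ) (θ : Fin n → ℝ) :
    (k : ℕ) → EuclideanSpace ℝ (Fin d) → Fin (dimAt d dims k) → ℝ
  | 0 => fun x i => x i
  | k + 1 => fun x i =>
      σ (k + 1) ((∑ j, paramEval θ (W k i j) * hiddenEval W b σ θ k x j) + paramEval θ (b k i))

/-- The deep net realized by the structure `S`, activations `σ` and parameters `θ`:
`h(x) = a ⬝ h_L(x)`. -/
def NetStructure.eval {n L d : ℕ} {dims : ℕ → ℕ} (S : NetStructure n L d dims)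
    (σ : ℕ → ℝ → ℝ) (θ : Fin n → ℝ) (x : EuclideanSpace ℝ (Fin d)) : ℝ :=
  ∑ i, paramEval θ (S.a i) * hiddenEval S.W S.b σ θ L x i

/-- All weights and thresholds (realized entries) are bounded by `R`. -/
def NetStructure.Bounded {n L d : ℕ} {dims : ℕ → ℕ} (S : NetStructure n L d dims)
    (R : ℝ) (θ : Fin n → ℝ) : Prop :=
  (∀ k < L, ∀ i j, |paramEval θ (S.W k i j)| ≤ R) ∧
    (∀ k < L, ∀ i, |paramEval θ (S.b k i)| ≤ R) ∧
    (∀ i, |paramEval θ (S.a i)| ≤ R)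

/-- The class `H_{n,L,σ,R}` of deep nets with the fixed structure `S`, whose
weights and thresholds are bounded by `R`. -/
def netClass {n L d : ℕ} {dims : ℕ → ℕ} (S : NetStructure n L d dims)
    (σ : ℕ → ℝ → ℝ) (R : ℝ) : Set (EuclideanSpace ℝ (Fin d) → ℝ) :=
  { f | ∃ θ : Fin n → ℝ, S.Bounded R θ ∧ f = S.eval σ θ }

/-- Partial derivative of `f` in the `i`-th coordinate direction. -/
def pderiv' {d : ℕ} (i : Fin d) (f : EuclideanSpace ℝ (Fin d) → ℝ) :
    EuclideanSpace ℝ (Fin d) → ℝ :=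
  fun x => fderiv ℝ f x (EuclideanSpace.single i 1)

/-- Iterated partial derivative of `f` along the list of coordinate directions `l`
(a list of length `s` corresponds to a multi-index `α` with `|α| = s`). -/
def iterPD {d : ℕ} : List (Fin d) → (EuclideanSpace ℝ (Fin d) → ℝ) →
    EuclideanSpace ℝ (Fin d) → ℝ
  | [], f => f
  | i :: l, f => iterPD l (pderiv' i f)

/-- The class `Lip^{(r,c₀)}` (with `r = s + v`, `0 < v ≤ 1`) of `(r,c₀)`-smooth
functions on `𝕀^d` : `f` is `s`-times differentiable and every `s`-th order
partial derivative is `v`-Hölder continuous on `𝕀^d` with constant `c₀`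
(with respect to the Euclidean norm). -/
def LipClass (d s : ℕ) (v c0 : ℝ) : Set (EuclideanSpace ℝ (Fin d) → ℝ) :=
  { f | ContDiff ℝ s f ∧
      ∀ l : List (Fin d), l.length = s →
        ∀ x ∈ cube d, ∀ y ∈ cube d,
          |iterPD l f x - iterPD l f y| ≤ c0 * ‖x - y‖ ^ v }

/-- Fewer than `2 ^ (M / 4)` sign patterns on `M` points cannot all together come within Hamming
distance `M / 8` of every sign pattern. -/
lemma exists_sign_pattern_far {ι τ : Type*} [Fintype ι] [DecidableEq ι] [Fintype τ]
    (g : τ → ι → Bool) (h : (Fintype.card τ : ℝ) < 2 ^ ((Fintype.card ι : ℝ) / 4)) :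
    ∃ ε : ι → Bool, ∀ t,
      (Fintype.card ι : ℝ) / 8 ≤ ((Finset.univ.filter fun j => ε j ≠ g t j).card : ℝ) := by
  by_contra! hcon
  set M : ℕ := Fintype.card ι with hM
  let w : Bool → Bool → ℝ := fun b b' => if b ≠ b' then 1 / 16 else 1
  have hw0 : ∀ b b', 0 ≤ w b b' := by
    intro b b'
    simp only [w]
    split_ifs <;> norm_num
  have hsum : ∀ t, ∑ ε : ι → Bool, ∏ j, w (ε j) (g t j) = (17 / 16 : ℝ) ^ M := by
    intro t
    have h1 := (Finset.prod_univ_sum (fun _ : ι => (Finset.univ : Finset Bool))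
      (fun j b => w b (g t j)))
    rw [Fintype.piFinset_univ] at h1
    rw [← h1]
    have h2 : ∀ j, ∑ b : Bool, w b (g t j) = 17 / 16 := by
      intro j
      cases g t j <;> simp [w] <;> norm_num
    simp only [h2, Finset.prod_const, Finset.card_univ, hM]
  have hlow : ∀ ε : ι → Bool, (2 : ℝ) ^ (-(M : ℝ) / 2) ≤ ∑ t, ∏ j, w (ε j) (g t j) := by
    intro ε
    obtain ⟨t, ht⟩ := hcon ε
    refine le_trans ?_ (Finset.single_le_sum (f := fun t => ∏ j, w (ε j) (g t j))
      (fun t _ => Finset.prod_nonneg fun j _ => hw0 _ _) (Finset.mem_univ t))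
    simp only [w]
    rw [Finset.prod_ite]
    rw [Finset.prod_const, Finset.prod_const_one, mul_one]
    have h16 : (1 / 16 : ℝ) = (2 : ℝ) ^ (-4 : ℝ) := by
      rw [Real.rpow_neg (by norm_num)]
      norm_num
    rw [h16, ← Real.rpow_mul_natCast (by norm_num)]
    apply Real.rpow_le_rpow_of_exponent_le (by norm_num)
    linarith
  have hcard : ∑ _ε : ι → Bool, (2 : ℝ) ^ (-(M : ℝ) / 2) = 2 ^ ((M : ℝ) / 2) := by
    simp only [Finset.sum_const, nsmul_eq_mul, Finset.card_univ, Fintype.card_fun,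
      Fintype.card_bool]
    push_cast
    rw [← Real.rpow_natCast, ← Real.rpow_add (by norm_num)]
    congr 1
    ring
  have hle : (2 : ℝ) ^ ((M : ℝ) / 2) ≤ Fintype.card τ * (17 / 16 : ℝ) ^ M := by
    rw [← hcard]
    refine (Finset.sum_le_sum fun ε _ => hlow ε).trans ?_
    rw [Finset.sum_comm]
    simp [hsum]
  have h17 : (17 / 16 : ℝ) ^ M ≤ 2 ^ ((M : ℝ) / 4) := by
    have : (17 / 16 : ℝ) ≤ 2 ^ (1 / 4 : ℝ) := by
      have h4 : ((17 / 16 : ℝ) ^ (4 : ℕ)) ^ (1 / 4 : ℝ) = 17 / 16 := by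
        rw [← Real.rpow_natCast, ← Real.rpow_mul (by norm_num)]
        norm_num
      rw [← h4]
      apply Real.rpow_le_rpow <;> norm_num
    refine (pow_le_pow_left₀ (by norm_num) this M).trans (le_of_eq ?_)
    rw [← Real.rpow_mul_natCast (by norm_num)]
    congr 1
    ring
  have hsplit : (2 : ℝ) ^ ((M : ℝ) / 2) = 2 ^ ((M : ℝ) / 4) * 2 ^ ((M : ℝ) / 4) := by
    rw [← Real.rpow_add (by norm_num)]
    congr 1
    ring
  have h1 : (Fintype.card τ : ℝ) * (17 / 16 : ℝ) ^ M ≤ Fintype.card τ * 2 ^ ((M : ℝ) / 4) := by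
    gcongr
  have h2 : (Fintype.card τ : ℝ) * 2 ^ ((M : ℝ) / 4) < 2 ^ ((M : ℝ) / 4) * 2 ^ ((M : ℝ) / 4) := by
    gcongr
  linarith

lemma continuous_hiddenEval {n d L : ℕ} {dims : ℕ → ℕ}
    (W : (k : ℕ) → Fin (dimAt d dims (k + 1)) → Fin (dimAt d dims k) → ℝ ⊕ Fin n)
    (b : (k : ℕ) → Fin (dimAt d dims (k + 1)) → ℝ ⊕ Fin n)
    {σ : ℕ → ℝ → ℝ} (hσ : ∀ k, 1 ≤ k → k ≤ L → Continuous (σ k)) (θ : Fin n → ℝ) :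
    ∀ k ≤ L, ∀ i, Continuous fun x => hiddenEval W b σ θ k x i
  | 0, _, i => by
    simp only [hiddenEval]
    fun_prop
  | k + 1, hk, i => by
    simp only [hiddenEval]
    have ih := continuous_hiddenEval W b hσ θ k (by omega)
    exact (hσ (k + 1) (by omega) hk).comp
      ((continuous_finsetSum _ fun j _ => continuous_const.mul (ih j)).add continuous_const)

lemma NetStructure.continuous_eval {n d L : ℕ} {dims : ℕ → ℕ} (S : NetStructure n L d dims)
    {σ : ℕ → ℝ → ℝ} (hσ : ∀ k, 1 ≤ k → k ≤ L → Continuous (σ k)) (θ : Fin n → ℝ) :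
    Continuous (S.eval σ θ) :=
  continuous_finsetSum _ fun i _ =>
    continuous_const.mul (continuous_hiddenEval S.W S.b hσ θ L le_rfl i)

/-- A sum of at most `D` products `w j * h j` is bounded by `D` times the product of the bounds. -/
lemma abs_sum_mul_le {m : ℕ} {D R H : ℝ} (hm : (m : ℝ) ≤ D) (hR : 0 ≤ R) (hH : 0 ≤ H)
    {w h : Fin m → ℝ} (hw : ∀ j, |w j| ≤ R) (hh : ∀ j, |h j| ≤ H) :
    |∑ j, w j * h j| ≤ D * (R * H) := by
  calc |∑ j, w j * h j| ≤ ∑ j, |w j * h j| := Finset.abs_sum_le_sum_abs _ _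
    _ ≤ ∑ _j : Fin m, R * H := by
        refine Finset.sum_le_sum fun j _ => ?_
        rw [abs_mul]
        exact mul_le_mul (hw j) (hh j) (abs_nonneg _) hR
    _ = m * (R * H) := by simp
    _ ≤ D * (R * H) := by gcongr

/-- Perturbing both factors of a sum of at most `D` products. -/
lemma abs_sum_mul_sub_le {m : ℕ} {D R H η Δ : ℝ} (hm : (m : ℝ) ≤ D) (hR : 0 ≤ R) (hH : 0 ≤ H)
    (hη : 0 ≤ η) (hΔ : 0 ≤ Δ) {w w' h h' : Fin m → ℝ} (hw' : ∀ j, |w' j| ≤ R)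
    (hww : ∀ j, |w j - w' j| ≤ η) (hh : ∀ j, |h j| ≤ H) (hhh : ∀ j, |h j - h' j| ≤ Δ) :
    |(∑ j, w j * h j) - ∑ j, w' j * h' j| ≤ D * (η * H) + D * (R * Δ) := by
  have : (∑ j, w j * h j) - ∑ j, w' j * h' j =
      (∑ j, (w j - w' j) * h j) + ∑ j, w' j * (h j - h' j) := by
    rw [← Finset.sum_sub_distrib, ← Finset.sum_add_distrib]
    refine Finset.sum_congr rfl fun j _ => ?_
    ring
  rw [this]
  exact (abs_add_le _ _).trans
    (add_le_add (abs_sum_mul_le hm hη hH hww hh) (abs_sum_mul_le hm hR hΔ hw' hhh))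

section Perturbation

variable {n L d : ℕ} {dims : ℕ → ℕ} {c c1 R D : ℝ} {σ : ℕ → ℝ → ℝ}

lemma abs_hiddenEval_le (S : NetStructure n L d dims) (hc : 1 ≤ c) (hc1 : 1 ≤ c1) (hR : 1 ≤ R)
    (hD : 1 ≤ D) (hdim : ∀ k ≤ L, (dimAt d dims k : ℝ) ≤ D)
    (hσ : ∀ k, 1 ≤ k → k ≤ L → ∀ t : ℝ, |σ k t| ≤ c * (|t| + 1))
    {θ : Fin n → ℝ} (hθ : S.Bounded R θ) {x : EuclideanSpace ℝ (Fin d)} (hx : x ∈ cube d) :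
    ∀ k ≤ L, ∀ i, |hiddenEval S.W S.b σ θ k x i| ≤ (3 * c * c1 * (R * D)) ^ k
  | 0, _, i => by simpa [hiddenEval] using hx i
  | k + 1, hk, i => by
    have ih := abs_hiddenEval_le S hc hc1 hR hD hdim hσ hθ hx k (by omega)
    simp only [hiddenEval]
    set P := (3 * c * c1 * (R * D)) ^ k with hP
    have hRD : 1 ≤ R * D := one_le_mul_of_one_le_of_one_le hR hD
    have hRRD : R ≤ R * D := le_mul_of_one_le_right (by linarith) hD
    have hcc : 1 ≤ c * c1 := one_le_mul_of_one_le_of_one_le hc hc1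
    have hQ : 1 ≤ 3 * c * c1 * (R * D) := by nlinarith
    have hP1 : 1 ≤ P := one_le_pow₀ hQ
    have hs := abs_sum_mul_le (hdim k (by omega)) (by linarith) (by linarith)
      (fun j => hθ.1 k (by omega) i j) ih
    have hb := hθ.2.1 k (by omega) i
    refine (hσ (k + 1) (by omega) hk _).trans ?_
    have h1 := abs_add_le (∑ j, paramEval θ (S.W k i j) * hiddenEval S.W S.b σ θ k x j)
      (paramEval θ (S.b k i))
    have h2 : R * D ≤ R * D * P := le_mul_of_one_le_right (by linarith) hP1
    calc _ ≤ c * (3 * (R * D * P)) := by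
          gcongr
          nlinarith
      _ ≤ c1 * (c * (3 * (R * D * P))) := le_mul_of_one_le_left (by positivity) hc1
      _ = (3 * c * c1 * (R * D)) ^ (k + 1) := by rw [pow_succ, ← hP]; ring

lemma abs_hiddenEval_sub_le (S : NetStructure n L d dims) (hc : 1 ≤ c) (hc1 : 1 ≤ c1)
    (hR : 1 ≤ R) (hD : 1 ≤ D) (hdim : ∀ k ≤ L, (dimAt d dims k : ℝ) ≤ D)
    (hσ1 : ∀ k, 1 ≤ k → k ≤ L → ∀ t t' : ℝ, |σ k t - σ k t'| ≤ c1 * |t - t'|)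
    (hσ : ∀ k, 1 ≤ k → k ≤ L → ∀ t : ℝ, |σ k t| ≤ c * (|t| + 1))
    {θ θ' : Fin n → ℝ} (hθ : S.Bounded R θ) (hθ' : S.Bounded R θ') {η : ℝ} (hη : 0 ≤ η)
    (hW : ∀ k < L, ∀ i j, |paramEval θ (S.W k i j) - paramEval θ' (S.W k i j)| ≤ η)
    (hb : ∀ k < L, ∀ i, |paramEval θ (S.b k i) - paramEval θ' (S.b k i)| ≤ η)
    {x : EuclideanSpace ℝ (Fin d)} (hx : x ∈ cube d) :
    ∀ k ≤ L, ∀ i, |hiddenEval S.W S.b σ θ k x i - hiddenEval S.W S.b σ θ' k x i| ≤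
      η * (3 * c * c1 * (R * D)) ^ k
  | 0, _, i => by simpa [hiddenEval] using hη
  | k + 1, hk, i => by
    have ih := abs_hiddenEval_sub_le S hc hc1 hR hD hdim hσ1 hσ hθ hθ' hη hW hb hx k (by omega)
    have hH := abs_hiddenEval_le S hc hc1 hR hD hdim hσ hθ hx k (by omega)
    simp only [hiddenEval]
    set P := (3 * c * c1 * (R * D)) ^ k with hP
    have hRD : 1 ≤ R * D := one_le_mul_of_one_le_of_one_le hR hD
    have hDRD : D ≤ R * D := le_mul_of_one_le_left (by linarith) hR
    have hcc : 1 ≤ c * c1 := one_le_mul_of_one_le_of_one_le hc hc1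
    have hQ : 1 ≤ 3 * c * c1 * (R * D) := by nlinarith
    have hP1 : 1 ≤ P := one_le_pow₀ hQ
    have hs := abs_sum_mul_sub_le (hdim k (by omega)) (by linarith) (by linarith) hη
      (by positivity) (fun j => hθ'.1 k (by omega) i j) (fun j => hW k (by omega) i j) hH ih
    refine (hσ1 (k + 1) (by omega) hk _ _).trans ?_
    rw [add_sub_add_comm]
    have h1 := (abs_add_le _ _).trans (add_le_add hs (hb k (by omega) i))
    have h3 : η ≤ R * D * (η * P) := by
      calc η ≤ η * P := le_mul_of_one_le_right hη hP1
        _ ≤ R * D * (η * P) := le_mul_of_one_le_left (by positivity) hRD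
    calc _ ≤ c1 * (3 * (R * D * (η * P))) := by
          gcongr
          nlinarith
      _ ≤ c * (c1 * (3 * (R * D * (η * P)))) := le_mul_of_one_le_left (by positivity) hc
      _ = η * (3 * c * c1 * (R * D)) ^ (k + 1) := by rw [pow_succ, ← hP]; ring

lemma NetStructure.abs_eval_sub_le (S : NetStructure n L d dims) (hc : 1 ≤ c) (hc1 : 1 ≤ c1)
    (hR : 1 ≤ R) (hD : 1 ≤ D) (hdim : ∀ k ≤ L, (dimAt d dims k : ℝ) ≤ D)
    (hσ1 : ∀ k, 1 ≤ k → k ≤ L → ∀ t t' : ℝ, |σ k t - σ k t'| ≤ c1 * |t - t'|)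
    (hσ : ∀ k, 1 ≤ k → k ≤ L → ∀ t : ℝ, |σ k t| ≤ c * (|t| + 1))
    {θ θ' : Fin n → ℝ} (hθ : S.Bounded R θ) (hθ' : S.Bounded R θ') {η : ℝ} (hη : 0 ≤ η)
    (hW : ∀ k < L, ∀ i j, |paramEval θ (S.W k i j) - paramEval θ' (S.W k i j)| ≤ η)
    (hb : ∀ k < L, ∀ i, |paramEval θ (S.b k i) - paramEval θ' (S.b k i)| ≤ η)
    (ha : ∀ i, |paramEval θ (S.a i) - paramEval θ' (S.a i)| ≤ η)
    {x : EuclideanSpace ℝ (Fin d)} (hx : x ∈ cube d) :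
    |S.eval σ θ x - S.eval σ θ' x| ≤ η * (3 * c * c1 * (R * D)) ^ (L + 1) := by
  have hΔ := abs_hiddenEval_sub_le S hc hc1 hR hD hdim hσ1 hσ hθ hθ' hη hW hb hx L le_rfl
  have hH := abs_hiddenEval_le S hc hc1 hR hD hdim hσ hθ hx L le_rfl
  set P := (3 * c * c1 * (R * D)) ^ L with hP
  have hDRD : D ≤ R * D := le_mul_of_one_le_left (by linarith) hR
  have hcc : 1 ≤ c * c1 := one_le_mul_of_one_le_of_one_le hc hc1
  have hP0 : 0 ≤ P := by positivity
  have hs := abs_sum_mul_sub_le (hdim L le_rfl) (by linarith) hP0 hη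
    (by positivity) hθ'.2.2 ha hH hΔ
  refine hs.trans ?_
  calc _ ≤ 3 * (R * D * (η * P)) := by
        have : 0 ≤ R * D * (η * P) := by positivity
        nlinarith
    _ ≤ (c * c1) * (3 * (R * D * (η * P))) := le_mul_of_one_le_left (by positivity) hcc
    _ = η * (3 * c * c1 * (R * D)) ^ (L + 1) := by rw [pow_succ, ← hP]; ring

/-- Every net of the class is uniformly close on the cube to one whose free parameters lie on a
grid with `2 * q + 1` points per coordinate. -/
lemma exists_grid_net (S : NetStructure n L d dims) (hc : 1 ≤ c) (hc1 : 1 ≤ c1)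
    (hR : 1 ≤ R) (hD : 1 ≤ D) (hdim : ∀ k ≤ L, (dimAt d dims k : ℝ) ≤ D)
    (hσ1 : ∀ k, 1 ≤ k → k ≤ L → ∀ t t' : ℝ, |σ k t - σ k t'| ≤ c1 * |t - t'|)
    (hσ : ∀ k, 1 ≤ k → k ≤ L → ∀ t : ℝ, |σ k t| ≤ c * (|t| + 1))
    {q : ℕ} (hq : 0 < q) {h : EuclideanSpace ℝ (Fin d) → ℝ} (hh : h ∈ netClass S σ R) :
    ∃ m : Fin n → Finset.Icc (-(q : ℤ)) q, ∀ x ∈ cube d,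
      |h x - S.eval σ (fun i => R * ((m i : ℤ) : ℝ) / q) x| ≤
        (3 * c * c1 * (R * D)) ^ (L + 2) / q := by
  obtain ⟨θ, hθ, rfl⟩ := hh
  have hq' : (0 : ℝ) < q := by exact_mod_cast hq
  have hR0 : 0 < R := by linarith
  have key : ∀ i, ∃ m : Finset.Icc (-(q : ℤ)) q, |R * ((m : ℤ) : ℝ) / q| ≤ R ∧
      (|θ i| ≤ R → |θ i - R * ((m : ℤ) : ℝ) / q| ≤ R / q) := by
    have hbd : ∀ m : Finset.Icc (-(q : ℤ)) q, |R * ((m : ℤ) : ℝ) / q| ≤ R := by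
      rintro ⟨m, hm⟩
      rw [Finset.mem_Icc] at hm
      have h1 : (-(q : ℝ)) ≤ m := by exact_mod_cast hm.1
      have h2 : (m : ℝ) ≤ q := by exact_mod_cast hm.2
      have h3 : |(m : ℝ)| ≤ q := abs_le.2 ⟨h1, h2⟩
      rw [abs_div, abs_mul, abs_of_pos hR0, abs_of_pos hq', div_le_iff₀ hq']
      gcongr
    intro i
    by_cases hi : |θ i| ≤ R
    · rw [abs_le] at hi
      have hm : ⌊θ i * q / R⌋ ∈ Finset.Icc (-(q : ℤ)) q := by
        rw [Finset.mem_Icc]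
        constructor
        · rw [Int.le_floor, le_div_iff₀ hR0]
          push_cast
          nlinarith
        · have : θ i * q / R ≤ (q : ℤ) := by
            rw [div_le_iff₀ hR0]
            push_cast
            nlinarith
          exact_mod_cast (Int.floor_le _).trans this
      refine ⟨⟨_, hm⟩, hbd _, fun _ => ?_⟩
      have h1 := Int.floor_le (θ i * q / R)
      have h2 := Int.lt_floor_add_one (θ i * q / R)
      have h3 : θ i - R * (⌊θ i * q / R⌋ : ℝ) / q =
          R / q * (θ i * q / R - ⌊θ i * q / R⌋) := by
        field_simp
      simp only
      rw [h3, abs_mul, abs_of_pos (by positivity)]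
      refine mul_le_of_le_one_right (by positivity) ?_
      rw [abs_le]
      constructor <;> linarith
    · exact ⟨⟨0, by simp⟩, hbd _, fun h => absurd h hi⟩
  choose m hm1 hm2 using key
  refine ⟨m, fun x hx => ?_⟩
  set θ' : Fin n → ℝ := fun i => R * ((m i : ℤ) : ℝ) / q with hθ'
  have hp1 : ∀ e, |paramEval θ e| ≤ R → |paramEval θ' e| ≤ R := by
    rintro (e | i) h
    · exact h
    · exact hm1 i
  have hp2 : ∀ e, |paramEval θ e| ≤ R → |paramEval θ e - paramEval θ' e| ≤ R / q := by
    rintro (e | i) h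
    · simp only [paramEval, Sum.elim_inl, sub_self, abs_zero]
      positivity
    · exact hm2 i h
  have := S.abs_eval_sub_le hc hc1 hR hD hdim hσ1 hσ hθ
    ⟨fun k hk i j => hp1 _ (hθ.1 k hk i j), fun k hk i => hp1 _ (hθ.2.1 k hk i),
      fun i => hp1 _ (hθ.2.2 i)⟩ (η := R / q) (by positivity)
    (fun k hk i j => hp2 _ (hθ.1 k hk i j)) (fun k hk i => hp2 _ (hθ.2.1 k hk i))
    (fun i => hp2 _ (hθ.2.2 i)) hx
  refine this.trans ?_
  have hRQ : R ≤ 3 * c * c1 * (R * D) := by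
    have h1 : 1 ≤ c * c1 := one_le_mul_of_one_le_of_one_le hc hc1
    have h2 : R ≤ R * D := le_mul_of_one_le_right hR0.le hD
    nlinarith
  rw [pow_succ _ (L + 1), div_mul_eq_mul_div, mul_comm R]
  gcongr

end Perturbation

section Bumps

open scoped ContDiff

variable {d : ℕ} {φ : EuclideanSpace ℝ (Fin d) → ℝ}

lemma ContDiff.pderiv' (hφ : ContDiff ℝ ∞ φ) (i : Fin d) : ContDiff ℝ ∞ (pderiv' i φ) :=
  (hφ.fderiv_right (m := ∞) (by simp)).clm_apply contDiff_const

lemma ContDiff.iterPD (l : List (Fin d)) :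
    ∀ {φ : EuclideanSpace ℝ (Fin d) → ℝ}, ContDiff ℝ ∞ φ → ContDiff ℝ ∞ (iterPD l φ) := by
  induction l with
  | nil => exact fun h => h
  | cons i l ih => exact fun h => ih (h.pderiv' i)

lemma tsupport_pderiv'_subset (i : Fin d) : tsupport (pderiv' i φ) ⊆ tsupport φ := by
  refine closure_minimal (fun x hx => ?_) (isClosed_tsupport φ)
  refine support_fderiv_subset ℝ (f := φ) ?_
  intro h
  exact hx (by simp [pderiv', h])

lemma tsupport_iterPD_subset (l : List (Fin d)) :
    ∀ {φ : EuclideanSpace ℝ (Fin d) → ℝ}, tsupport (iterPD l φ) ⊆ tsupport φ := by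
  induction l with
  | nil => exact fun {φ} => subset_rfl
  | cons i l ih => exact fun {φ} => ih.trans (tsupport_pderiv'_subset i)

/-- Iterated partial derivatives of a linear combination of dilated translates. -/
lemma iterPD_sum_dilate {ι : Type*} [Fintype ι] (N : ℝ) (z : ι → EuclideanSpace ℝ (Fin d))
    (l : List (Fin d)) :
    ∀ {φ : EuclideanSpace ℝ (Fin d) → ℝ}, ContDiff ℝ ∞ φ → ∀ c : ι → ℝ,
      iterPD l (fun x => ∑ j, c j * φ (N • x - z j)) =
        fun x => ∑ j, c j * N ^ l.length * iterPD l φ (N • x - z j) := by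
  induction l with
  | nil => simp [iterPD]
  | cons i l ih =>
    intro φ hφ c
    have key : pderiv' i (fun x => ∑ j, c j * φ (N • x - z j)) =
        fun x => ∑ j, (c j * N) * pderiv' i φ (N • x - z j) := by
      funext x
      have h1 : ∀ j, HasFDerivAt (fun x => c j * φ (N • x - z j))
          (c j • ((fderiv ℝ φ (N • x - z j)).comp
            (N • ContinuousLinearMap.id ℝ (EuclideanSpace ℝ (Fin d))))) x := by
        intro j
        have h2 : HasFDerivAt (fun x : EuclideanSpace ℝ (Fin d) => N • x - z j)
            (N • ContinuousLinearMap.id ℝ (EuclideanSpace ℝ (Fin d))) x :=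
          ((hasFDerivAt_id x).const_smul N).sub_const (z j)
        have h3 : HasFDerivAt φ (fderiv ℝ φ (N • x - z j)) (N • x - z j) :=
          (hφ.differentiable (by simp)).differentiableAt.hasFDerivAt
        exact (h3.comp x h2).const_mul (c j)
      have h4 := (HasFDerivAt.fun_sum (u := Finset.univ) fun j _ => h1 j).fderiv
      simp only [pderiv', h4]
      simp [mul_assoc]
    simp only [iterPD]
    rw [key, ih (hφ.pderiv' i)]
    funext x
    refine Finset.sum_congr rfl fun j _ => ?_
    rw [List.length_cons, pow_succ]
    ring

/-- A smooth compactly supported function is Hölder of any exponent in `[0, 1]`, with a uniform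
constant. -/
lemma exists_holder_bound (hφ : ContDiff ℝ ∞ φ) (hs : HasCompactSupport φ) :
    ∃ B : ℝ, 0 ≤ B ∧ ∀ v : ℝ, 0 ≤ v → v ≤ 1 → ∀ x y, |φ x - φ y| ≤ B * ‖x - y‖ ^ v := by
  obtain ⟨B1, hB1⟩ := hs.exists_bound_of_continuous hφ.continuous
  obtain ⟨B2, hB2⟩ := hφ.lipschitzWith_of_hasCompactSupport hs (by simp)
  have hB10 : 0 ≤ B1 := (norm_nonneg _).trans (hB1 0)
  refine ⟨2 * B1 + B2, by positivity, fun v hv hv1 x y => ?_⟩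
  rcases le_total 1 ‖x - y‖ with h | h
  · have h1 : 1 ≤ ‖x - y‖ ^ v := Real.one_le_rpow h hv
    have h2 : |φ x - φ y| ≤ 2 * B1 := by
      have := abs_sub (φ x) (φ y)
      have := hB1 x
      have := hB1 y
      simp only [Real.norm_eq_abs] at *
      linarith
    have h4 : (0 : ℝ) ≤ B2 := B2.2
    nlinarith
  · have h1 : ‖x - y‖ ≤ ‖x - y‖ ^ v := by
      rcases (norm_nonneg (x - y)).eq_or_lt with h0 | h0
      · rw [← h0]
        exact Real.rpow_nonneg le_rfl _
      · simpa using Real.rpow_le_rpow_of_exponent_ge h0 h hv1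
    have h2 := hB2.dist_le_mul x y
    rw [Real.dist_eq, dist_eq_norm] at h2
    nlinarith [Real.rpow_nonneg (norm_nonneg (x - y)) v]

/-- A sum of signed translates of a Hölder function supported in a small ball, along a
separated family of centers, is again Hölder with twice the constant. -/
lemma abs_sum_translate_sub_le {ι : Type*} [Fintype ι] {z : ι → EuclideanSpace ℝ (Fin d)}
    (hz : ∀ i j, i ≠ j → 1 ≤ dist (z i) (z j)) {ψ : EuclideanSpace ℝ (Fin d) → ℝ}
    (hψ : ∀ x, 1 / 3 < ‖x‖ → ψ x = 0) {B v : ℝ} (hB : 0 ≤ B)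
    (hH : ∀ x y, |ψ x - ψ y| ≤ B * ‖x - y‖ ^ v) {ε : ι → ℝ} (hε : ∀ j, |ε j| ≤ 1)
    (x y : EuclideanSpace ℝ (Fin d)) :
    |∑ j, ε j * ψ (x - z j) - ∑ j, ε j * ψ (y - z j)| ≤ 2 * B * ‖x - y‖ ^ v := by
  classical
  have hone : ∀ w, (Finset.univ.filter fun j => ‖w - z j‖ ≤ 1 / 3).card ≤ 1 := by
    intro w
    rw [Finset.card_le_one]
    intro i hi j hj
    by_contra hij
    simp only [Finset.mem_filter, Finset.mem_univ, true_and] at hi hj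
    have h1 := hz i j hij
    have h2 := dist_triangle_left (z i) (z j) w
    rw [dist_eq_norm w, dist_eq_norm w] at h2
    linarith
  set J := (Finset.univ.filter fun j => ‖x - z j‖ ≤ 1 / 3) ∪
    (Finset.univ.filter fun j => ‖y - z j‖ ≤ 1 / 3) with hJ
  have hcard : (J.card : ℝ) ≤ 2 := by
    have : J.card ≤ 2 := (Finset.card_union_le _ _).trans (add_le_add (hone x) (hone y))
    exact_mod_cast this
  have hsub : ∑ j, ε j * ψ (x - z j) - ∑ j, ε j * ψ (y - z j) =
      ∑ j ∈ J, ε j * (ψ (x - z j) - ψ (y - z j)) := by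
    rw [← Finset.sum_sub_distrib]
    symm
    simp_rw [mul_sub]
    refine Finset.sum_subset (Finset.subset_univ _) fun j _ hj => ?_
    simp only [hJ, Finset.mem_union, Finset.mem_filter, Finset.mem_univ, true_and, not_or,
      not_le] at hj
    rw [hψ _ hj.1, hψ _ hj.2]
    simp
  rw [hsub]
  calc _ ≤ ∑ j ∈ J, |ε j * (ψ (x - z j) - ψ (y - z j))| := Finset.abs_sum_le_sum_abs _ _
    _ ≤ ∑ j ∈ J, B * ‖x - y‖ ^ v := by
        refine Finset.sum_le_sum fun j _ => ?_
        rw [abs_mul]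
        have h := hH (x - z j) (y - z j)
        rw [sub_sub_sub_cancel_right] at h
        exact (mul_le_of_le_one_left (abs_nonneg _) (hε j)).trans h
    _ = J.card * (B * ‖x - y‖ ^ v) := by simp
    _ ≤ 2 * (B * ‖x - y‖ ^ v) := by gcongr
    _ = 2 * B * ‖x - y‖ ^ v := by ring

/-- A fixed bump profile, all of whose signed separated superpositions, rescaled by `N`, lie in the
class `Lip^{(r,c₀)}` after multiplication by `κ * N ^ (-r)`. -/
lemma exists_bump_profile (d s : ℕ) {v c0 : ℝ} (hv : 0 < v) (hv1 : v ≤ 1) (hc0 : 0 < c0) :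
    ∃ (κ : ℝ) (φ : EuclideanSpace ℝ (Fin d) → ℝ), 0 < κ ∧
      (∀ x, ‖x‖ ≤ 1 / 4 → φ x = 1) ∧ (∀ x, 1 / 3 < ‖x‖ → φ x = 0) ∧
      ∀ (N : ℕ), 0 < N → ∀ (ι : Type) [Fintype ι] (z : ι → EuclideanSpace ℝ (Fin d)),
        (∀ i j, i ≠ j → 1 ≤ dist (z i) (z j)) → ∀ ε : ι → ℝ, (∀ j, |ε j| ≤ 1) →
          (fun x => ∑ j, (κ * (N : ℝ) ^ (-(s + v)) * ε j) * φ ((N : ℝ) • x - z j)) ∈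
            LipClass d s v c0 := by
  let f : ContDiffBump (0 : EuclideanSpace ℝ (Fin d)) := ⟨1 / 4, 1 / 3, by norm_num, by norm_num⟩
  have hf : ContDiff ℝ ∞ f := f.contDiff
  have hsupp : ∀ l : List (Fin d), ∀ x, 1 / 3 < ‖x‖ → iterPD l f x = 0 := by
    intro l x hx
    refine image_eq_zero_of_notMem_tsupport fun h => ?_
    have h1 := tsupport_iterPD_subset l h
    rw [f.tsupport_eq, mem_closedBall_zero_iff] at h1
    exact absurd h1 (not_le.2 hx)
  have hB : ∀ l : List (Fin d), ∃ B : ℝ, 0 ≤ B ∧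
      ∀ x y, |iterPD l f x - iterPD l f y| ≤ B * ‖x - y‖ ^ v := by
    intro l
    obtain ⟨B, hB0, hB⟩ := exists_holder_bound (hf.iterPD l)
      (f.hasCompactSupport.of_isClosed_subset (isClosed_tsupport _) (tsupport_iterPD_subset l))
    exact ⟨B, hB0, hB v hv.le hv1⟩
  choose B hB0 hB using hB
  obtain ⟨B', hB'⟩ := ((List.finite_length_eq (Fin d) s).image B).bddAbove
  set B1 := max B' 1 with hB1
  have hB1pos : 0 < B1 := lt_max_of_lt_right one_pos
  refine ⟨c0 / (2 * B1), f, by positivity,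
    fun x hx => f.one_of_mem_closedBall (mem_closedBall_zero_iff.2 hx),
    hsupp [], ?_⟩
  intro N hN ι _ z hz ε hε
  have hN' : (0 : ℝ) < N := by exact_mod_cast hN
  refine ⟨?_, ?_⟩
  · refine ContDiff.sum fun j _ => contDiff_const.mul ?_
    exact (hf.of_le (by exact_mod_cast le_top)).comp
      ((contDiff_const_smul _).sub contDiff_const)
  · intro l hl x _ y _
    rw [iterPD_sum_dilate _ _ _ hf, hl]
    have hBl : B l ≤ B1 := (hB' ⟨l, hl, rfl⟩).trans (le_max_left _ _)
    have hmain := abs_sum_translate_sub_le hz (hsupp l) (hB0 l) (hB l) hε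
      ((N : ℝ) • x) ((N : ℝ) • y)
    set K : ℝ := c0 / (2 * B1) * (N : ℝ) ^ (-(s + v)) * (N : ℝ) ^ s with hK
    have hK0 : 0 ≤ K := by positivity
    have hpull : ∀ w : EuclideanSpace ℝ (Fin d),
        ∑ j, c0 / (2 * B1) * (N : ℝ) ^ (-(s + v)) * ε j * (N : ℝ) ^ s *
          iterPD l f ((N : ℝ) • w - z j) = K * ∑ j, ε j * iterPD l f ((N : ℝ) • w - z j) := by
      intro w
      rw [Finset.mul_sum]
      refine Finset.sum_congr rfl fun j _ => ?_
      rw [hK]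
      ring
    simp only [hpull]
    rw [← mul_sub, abs_mul, abs_of_nonneg hK0]
    rw [← smul_sub, norm_smul, Real.norm_of_nonneg hN'.le,
      Real.mul_rpow hN'.le (norm_nonneg _)] at hmain
    have hNpow : (N : ℝ) ^ (-(s + v)) * (N : ℝ) ^ s * (N : ℝ) ^ v = 1 := by
      rw [← Real.rpow_natCast, ← Real.rpow_add hN', ← Real.rpow_add hN']
      ring_nf
      exact Real.rpow_zero _
    calc _ ≤ K * (2 * B l * ((N : ℝ) ^ v * ‖x - y‖ ^ v)) := by gcongr
      _ ≤ K * (2 * B1 * ((N : ℝ) ^ v * ‖x - y‖ ^ v)) := by gcongr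
      _ = c0 * ‖x - y‖ ^ v * ((N : ℝ) ^ (-(s + v)) * (N : ℝ) ^ s * (N : ℝ) ^ v) := by
          rw [hK]
          field_simp
      _ = c0 * ‖x - y‖ ^ v := by rw [hNpow, mul_one]

end Bumps

section Separation

/-- No function is closer than `a` in the mean to both `a` and `-a`. -/
lemma le_lintegral_sub_or_le_lintegral_neg_sub {α : Type*} [MeasurableSpace α] (μ : Measure α)
    [IsFiniteMeasure μ] {a : ℝ} (ha : 0 ≤ a) {H : α → ℝ} (hH : Measurable H) :
    ENNReal.ofReal a * μ Set.univ ≤ ∫⁻ x, ‖a - H x‖ₑ ∂μ ∨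
      ENNReal.ofReal a * μ Set.univ ≤ ∫⁻ x, ‖-a - H x‖ₑ ∂μ := by
  by_contra! hcon
  have h1 : ENNReal.ofReal a * μ Set.univ + ENNReal.ofReal a * μ Set.univ ≤
      (∫⁻ x, ‖a - H x‖ₑ ∂μ) + ∫⁻ x, ‖-a - H x‖ₑ ∂μ := by
    rw [← lintegral_add_left (by fun_prop), ← add_mul, ← ENNReal.ofReal_add ha ha,
      ← lintegral_const]
    refine lintegral_mono fun x => ?_
    have h2 : a + a = (a - H x) - (-a - H x) := by ring
    rw [← Real.enorm_eq_ofReal (by linarith), h2]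
    exact enorm_sub_le
  exact absurd h1 (not_le.2 (ENNReal.add_lt_add hcon.1 hcon.2))

variable {d : ℕ}

/-- Half-integer lattice points with coordinates in `[0, N]`. -/
def halfLattice {N : ℕ} (j : Fin d → Fin N) : EuclideanSpace ℝ (Fin d) :=
  WithLp.toLp 2 fun i => (j i : ℝ) + 1 / 2

lemma abs_apply_le_norm (x : EuclideanSpace ℝ (Fin d)) (i : Fin d) : |x i| ≤ ‖x‖ :=
  PiLp.norm_apply_le x i

lemma one_le_dist_halfLattice {N : ℕ} {j k : Fin d → Fin N} (h : j ≠ k) :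
    1 ≤ dist (halfLattice j) (halfLattice k) := by
  obtain ⟨i, hi⟩ := Function.ne_iff.1 h
  rw [dist_eq_norm]
  refine le_trans ?_ (abs_apply_le_norm _ i)
  have h1 : ((j i : ℕ) : ℤ) - (k i : ℕ) ≠ 0 := by
    rw [sub_ne_zero]
    exact_mod_cast fun h => hi (Fin.ext h)
  have h2 : (1 : ℝ) ≤ |(((j i : ℕ) : ℤ) - (k i : ℕ) : ℤ)| := by exact_mod_cast Int.one_le_abs h1
  simpa [halfLattice] using h2

/-- The ball of radius `1 / (4 * N)` around a rescaled lattice point. -/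
def latticeBall {N : ℕ} (j : Fin d → Fin N) : Set (EuclideanSpace ℝ (Fin d)) :=
  Metric.ball ((N : ℝ)⁻¹ • halfLattice j) (1 / (4 * N))

lemma norm_smul_sub_halfLattice_lt {N : ℕ} (hN : 0 < N) {j : Fin d → Fin N}
    {x : EuclideanSpace ℝ (Fin d)} (hx : x ∈ latticeBall j) :
    ‖(N : ℝ) • x - halfLattice j‖ < 1 / 4 := by
  have hN' : (0 : ℝ) < N := by exact_mod_cast hN
  rw [latticeBall, mem_ball_iff_norm] at hx
  have h1 : (N : ℝ) • x - halfLattice j = (N : ℝ) • (x - (N : ℝ)⁻¹ • halfLattice j) := by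
    rw [smul_sub, smul_inv_smul₀ hN'.ne']
  rw [h1, norm_smul, Real.norm_of_nonneg hN'.le]
  calc _ < (N : ℝ) * (1 / (4 * N)) := by gcongr
    _ = 1 / 4 := by field_simp

lemma lt_norm_smul_sub_halfLattice {N : ℕ} (hN : 0 < N) {j k : Fin d → Fin N} (hjk : j ≠ k)
    {x : EuclideanSpace ℝ (Fin d)} (hx : x ∈ latticeBall j) :
    1 / 3 < ‖(N : ℝ) • x - halfLattice k‖ := by
  have h1 := norm_smul_sub_halfLattice_lt hN hx
  have h2 := one_le_dist_halfLattice hjk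
  have h3 := dist_triangle_left (halfLattice j) (halfLattice k) ((N : ℝ) • x)
  rw [dist_eq_norm ((N : ℝ) • x), dist_eq_norm ((N : ℝ) • x)] at h3
  linarith

lemma latticeBall_subset_cube {N : ℕ} (hN : 0 < N) (j : Fin d → Fin N) :
    latticeBall j ⊆ cube d := by
  intro x hx i
  have h1 := (abs_apply_le_norm _ i).trans_lt (norm_smul_sub_halfLattice_lt hN hx)
  have h2 : (((j i : ℕ) : ℝ) + 1) ≤ N := by exact_mod_cast (j i).2
  simp only [halfLattice, PiLp.sub_apply, PiLp.smul_apply, smul_eq_mul, abs_lt] at h1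
  rw [abs_le]
  constructor <;> nlinarith [h1.1, h1.2]

lemma pairwise_disjoint_latticeBall {N : ℕ} (hN : 0 < N) :
    Pairwise (Function.onFun Disjoint (latticeBall : (Fin d → Fin N) → Set _)) := by
  intro j k hjk
  refine Set.disjoint_left.2 fun x hx hx' => ?_
  have h1 := lt_norm_smul_sub_halfLattice hN hjk hx
  have h2 := norm_smul_sub_halfLattice_lt hN hx'
  linarith

lemma measurableSet_latticeBall {N : ℕ} (j : Fin d → Fin N) : MeasurableSet (latticeBall j) :=
  Metric.isOpen_ball.measurableSet

lemma volume_latticeBall {N : ℕ} (hN : 0 < N) (j : Fin d → Fin N) :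
    volume (latticeBall j) = ENNReal.ofReal ((1 / (4 * (N : ℝ))) ^ d) *
      volume (Metric.ball (0 : EuclideanSpace ℝ (Fin d)) 1) := by
  rw [latticeBall, Measure.addHaar_ball_of_pos _ _ (by positivity), finrank_euclideanSpace_fin]

/-- Among the signed superpositions of bumps of height `a` over an `N × ⋯ × N` grid, one is far in
`L¹` from every member of a given small family. -/
lemma exists_signs_far {φ : EuclideanSpace ℝ (Fin d) → ℝ} (hφ1 : ∀ x, ‖x‖ ≤ 1 / 4 → φ x = 1)
    (hφ0 : ∀ x, 1 / 3 < ‖x‖ → φ x = 0) {a : ℝ} (ha : 0 ≤ a) {N : ℕ} (hN : 0 < N)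
    {τ : Type*} [Fintype τ] (hτ : (Fintype.card τ : ℝ) < 2 ^ ((N : ℝ) ^ d / 4))
    {H : τ → EuclideanSpace ℝ (Fin d) → ℝ} (hH : ∀ t, Measurable (H t)) :
    ∃ ε : (Fin d → Fin N) → ℝ, (∀ j, |ε j| ≤ 1) ∧ ∀ t,
      ENNReal.ofReal (a / (8 * 4 ^ d) *
        volume.real (Metric.ball (0 : EuclideanSpace ℝ (Fin d)) 1)) ≤
      ∫⁻ x in cube d, ‖(∑ j, a * ε j * φ ((N : ℝ) • x - halfLattice j)) - H t x‖ₑ := by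
  classical
  set ω := volume (Metric.ball (0 : EuclideanSpace ℝ (Fin d)) 1) with hω
  have hωtop : ω ≠ ⊤ := measure_ball_lt_top.ne
  let g : τ → (Fin d → Fin N) → Bool := fun t j =>
    !decide (ENNReal.ofReal a * volume (latticeBall j) ≤ ∫⁻ x in latticeBall j, ‖a - H t x‖ₑ)
  obtain ⟨e, he⟩ := exists_sign_pattern_far g (by simpa using hτ)
  let ε : (Fin d → Fin N) → ℝ := fun j => if e j then 1 else -1
  have hε : ∀ j, |ε j| ≤ 1 := by
    intro j
    simp only [ε]
    split_ifs <;> simp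
  refine ⟨ε, hε, fun t => ?_⟩
  set F : EuclideanSpace ℝ (Fin d) → ℝ :=
    fun x => ∑ j, a * ε j * φ ((N : ℝ) • x - halfLattice j) with hF
  have hFball : ∀ j, ∀ x ∈ latticeBall j, F x = a * ε j := by
    intro j x hx
    simp only [hF]
    rw [Finset.sum_eq_single j]
    · rw [hφ1 _ (norm_smul_sub_halfLattice_lt hN hx).le, mul_one]
    · intro k _ hk
      rw [hφ0 _ (lt_norm_smul_sub_halfLattice hN hk.symm hx), mul_zero]
    · simp
  have hball : ∀ j, e j ≠ g t j → ENNReal.ofReal a * volume (latticeBall j) ≤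
      ∫⁻ x in latticeBall j, ‖F x - H t x‖ₑ := by
    intro j hj
    have : IsFiniteMeasure (volume.restrict (latticeBall j)) :=
      ⟨by simpa [latticeBall] using measure_ball_lt_top⟩
    rw [setLIntegral_congr_fun (g := fun x => ‖a * ε j - H t x‖ₑ) (measurableSet_latticeBall j)
      fun x hx => by simp only [hFball j x hx]]
    have hor := le_lintegral_sub_or_le_lintegral_neg_sub (volume.restrict (latticeBall j)) ha (hH t)
    rw [Measure.restrict_apply_univ] at hor
    by_cases hcase : ENNReal.ofReal a * volume (latticeBall j) ≤
        ∫⁻ x in latticeBall j, ‖a - H t x‖ₑ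
    · have : e j = true := by simpa [g, hcase] using hj
      simpa [ε, this] using hcase
    · have : e j = false := by simpa [g, hcase] using hj
      simpa [ε, this] using hor.resolve_left hcase
  set J := Finset.univ.filter fun j => e j ≠ g t j with hJ
  have hJcard : ((N : ℝ) ^ d) / 8 ≤ J.card := by simpa using he t
  calc ENNReal.ofReal (a / (8 * 4 ^ d) *
        volume.real (Metric.ball (0 : EuclideanSpace ℝ (Fin d)) 1))
      ≤ ENNReal.ofReal (J.card * (a * ((1 / (4 * (N : ℝ))) ^ d * ω.toReal))) := by
        apply ENNReal.ofReal_le_ofReal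
        have h1 : a / (8 * 4 ^ d) * volume.real (Metric.ball (0 : EuclideanSpace ℝ (Fin d)) 1) =
            (N : ℝ) ^ d / 8 * (a * ((1 / (4 * (N : ℝ))) ^ d * ω.toReal)) := by
          rw [Measure.real, ← hω, div_pow, mul_pow]
          field_simp
          simp
        rw [h1]
        gcongr
    _ = ∑ j ∈ J, ENNReal.ofReal a * volume (latticeBall j) := by
        simp only [volume_latticeBall hN, Finset.sum_const, nsmul_eq_mul]
        rw [ENNReal.ofReal_mul (by positivity), ENNReal.ofReal_mul ha,
          ENNReal.ofReal_mul (by positivity), ENNReal.ofReal_toReal hωtop, ENNReal.ofReal_natCast]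
    _ ≤ ∑ j ∈ J, ∫⁻ x in latticeBall j, ‖F x - H t x‖ₑ :=
        Finset.sum_le_sum fun j hj => hball j (Finset.mem_filter.1 hj).2
    _ = ∫⁻ x in ⋃ j ∈ J, latticeBall j, ‖F x - H t x‖ₑ :=
        (lintegral_biUnion_finset (fun i _ j _ hij => pairwise_disjoint_latticeBall hN hij)
          (fun j _ => measurableSet_latticeBall j) _).symm
    _ ≤ ∫⁻ x in cube d, ‖F x - H t x‖ₑ :=
        lintegral_mono_set (Set.iUnion₂_subset fun j _ => latticeBall_subset_cube hN j)

end Separation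

/-- Linear growth eventually beats logarithmic growth. -/
lemma exists_add_mul_logb_lt (a r : ℝ) (hr : 0 < r) :
    ∃ K : ℝ, 1 ≤ K ∧ 4 * (a + r * Real.logb 2 K) < K := by
  have hlog2 : 0 < Real.log 2 := Real.log_pos (by norm_num)
  have h1 := Real.isLittleO_log_id_atTop.def (c := Real.log 2 / (8 * r)) (by positivity)
  obtain ⟨K, hK1, hK2, hK3⟩ := (h1.and ((Filter.eventually_ge_atTop 1).and
    (Filter.eventually_gt_atTop (8 * a)))).exists
  refine ⟨K, hK2, ?_⟩
  simp only [id, Real.norm_eq_abs] at hK1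
  rw [abs_of_nonneg (show (0 : ℝ) ≤ K by linarith)] at hK1
  have h2 : Real.logb 2 K ≤ K / (8 * r) := by
    rw [Real.logb, div_le_iff₀ hlog2]
    calc _ ≤ _ := (le_abs_self _).trans hK1
      _ = _ := by ring
  have h3 : r * Real.logb 2 K ≤ K / 8 := by
    calc _ ≤ r * (K / (8 * r)) := by gcongr
      _ = K / 8 := by field_simp
  linarith

lemma Real.logb_two_le_self {t : ℝ} (ht : 1 ≤ t) : Real.logb 2 t ≤ t := by
  rw [Real.logb_le_iff_le_rpow (by norm_num) (by linarith)]
  have := one_add_mul_self_le_rpow_one_add (s := 1) (by norm_num) ht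
  norm_num at this
  linarith

/-- Choice of the grid resolution `N` and of the parameter discretization `q`. -/
lemma exists_resolution {d : ℕ} (hd : 1 ≤ d) {A Q r : ℝ} (hA : 1 ≤ A) (hQ : 1 ≤ Q) (hr : 0 < r) :
    ∃ K : ℝ, 1 ≤ K ∧ ∀ L n : ℕ, 1 ≤ L → 2 ≤ n → ∀ Y : ℝ, 2 ≤ Y →
      ∃ N q : ℕ, 0 < N ∧ 0 < q ∧
        (N : ℝ) ≤ 2 * (K * ((L : ℝ) ^ 2 * n * Real.logb 2 n * Real.logb 2 Y)) ^ (1 / (d : ℝ)) ∧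
        A * (Q * Y) ^ (L + 2) * (N : ℝ) ^ r ≤ q ∧
        (2 * (q : ℝ) + 1) ^ n < 2 ^ ((N : ℝ) ^ d / 4) := by
  obtain ⟨K, hK1, hK⟩ := exists_add_mul_logb_lt
    (Real.logb 2 (6 * A) + 3 * Real.logb 2 Q + 3 + 6 * r) r hr
  refine ⟨K, hK1, fun L n hL hn Y hY => ?_⟩
  have hL' : (1 : ℝ) ≤ L := by exact_mod_cast hL
  have hn' : (2 : ℝ) ≤ n := by exact_mod_cast hn
  have hd' : (1 : ℝ) ≤ d := by exact_mod_cast hd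
  have hone : ∀ t : ℝ, 2 ≤ t → 1 ≤ Real.logb 2 t := by
    intro t ht
    rw [Real.le_logb_iff_rpow_le (by norm_num) (by linarith)]
    simpa using ht
  have hΛ := hone n hn'
  have hl := hone Y hY
  set Λ := Real.logb 2 n with hΛdef
  set ℓ := Real.logb 2 Y with hldef
  set X : ℝ := (L : ℝ) ^ 2 * n * Λ * ℓ with hX
  have hL2 : 1 ≤ (L : ℝ) ^ 2 := one_le_pow₀ hL'
  have hX1 : 1 ≤ X := by
    refine one_le_mul_of_one_le_of_one_le (one_le_mul_of_one_le_of_one_le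
      (one_le_mul_of_one_le_of_one_le hL2 (by linarith)) hΛ) hl
  have hKX : 1 ≤ K * X := one_le_mul_of_one_le_of_one_le hK1 hX1
  have hroot : 1 ≤ (K * X) ^ (1 / (d : ℝ)) := Real.one_le_rpow hKX (by positivity)
  set N := ⌈(K * X) ^ (1 / (d : ℝ))⌉₊ with hN
  have hN1 : (K * X) ^ (1 / (d : ℝ)) ≤ N := Nat.le_ceil _
  have hN2 : (N : ℝ) ≤ 2 * (K * X) ^ (1 / (d : ℝ)) := by
    have := Nat.ceil_lt_add_one (show 0 ≤ (K * X) ^ (1 / (d : ℝ)) by linarith)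
    rw [← hN] at this
    linarith
  have hN0 : (1 : ℝ) ≤ N := hroot.trans hN1
  have hNd : K * X ≤ (N : ℝ) ^ d := by
    calc K * X = ((K * X) ^ (1 / (d : ℝ))) ^ d := by
          rw [← Real.rpow_mul_natCast (by linarith), one_div_mul_cancel (by linarith),
            Real.rpow_one]
      _ ≤ _ := by gcongr
  have hNr : 1 ≤ (N : ℝ) ^ r := Real.one_le_rpow hN0 hr.le
  have hQY : 1 ≤ Q * Y := one_le_mul_of_one_le_of_one_le hQ (by linarith)
  set P := A * (Q * Y) ^ (L + 2) * (N : ℝ) ^ r with hP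
  have hP1 : 1 ≤ P := one_le_mul_of_one_le_of_one_le
    (one_le_mul_of_one_le_of_one_le hA (one_le_pow₀ hQY)) hNr
  set q := ⌈P⌉₊ with hq
  have hq1 : P ≤ q := Nat.le_ceil _
  have hq2 : (q : ℝ) ≤ 2 * P := by
    have := Nat.ceil_lt_add_one (show 0 ≤ P by linarith)
    rw [← hq] at this
    linarith
  have hm1 : 1 ≤ L * Λ * ℓ :=
    one_le_mul_of_one_le_of_one_le (one_le_mul_of_one_le_of_one_le hL' hΛ) hl
  have hLm : (L : ℝ) ≤ L * Λ * ℓ := by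
    rw [mul_assoc]
    exact le_mul_of_one_le_right (by linarith) (one_le_mul_of_one_le_of_one_le hΛ hl)
  have hΛm : Λ ≤ L * Λ * ℓ := by
    rw [mul_right_comm]
    exact le_mul_of_one_le_left (by linarith) (one_le_mul_of_one_le_of_one_le hL' hl)
  have hlm : ℓ ≤ L * Λ * ℓ :=
    le_mul_of_one_le_left (by linarith) (one_le_mul_of_one_le_of_one_le hL' hΛ)
  have hLlm : L * ℓ ≤ L * Λ * ℓ := by
    rw [mul_right_comm]
    exact le_mul_of_one_le_right (by positivity) hΛ
  have hmX : n * (L * Λ * ℓ) ≤ X := by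
    calc n * (L * Λ * ℓ) ≤ L * (n * (L * Λ * ℓ)) := le_mul_of_one_le_left (by positivity) hL'
      _ = X := by rw [hX]; ring
  have hlogX : Real.logb 2 X ≤ 5 * (L * Λ * ℓ) := by
    have h1 : Real.logb 2 X = 2 * Real.logb 2 L + Λ + Real.logb 2 Λ + Real.logb 2 ℓ := by
      rw [hX, Real.logb_mul (by positivity) (by positivity),
        Real.logb_mul (by positivity) (by positivity),
        Real.logb_mul (by positivity) (by positivity), Real.logb_pow]
      push_cast
      ring
    have h2 := Real.logb_two_le_self hL'
    have h3 := Real.logb_two_le_self hΛ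
    have h4 := Real.logb_two_le_self hl
    linarith
  have hlogK : 0 ≤ Real.logb 2 K := Real.logb_nonneg (by norm_num) hK1
  have hlogA : 0 ≤ Real.logb 2 (6 * A) := Real.logb_nonneg (by norm_num) (by linarith)
  have hlogQ : 0 ≤ Real.logb 2 Q := Real.logb_nonneg (by norm_num) hQ
  have hlogN : Real.logb 2 N ≤ 1 + Real.logb 2 K + Real.logb 2 X := by
    have h1 : (N : ℝ) ≤ 2 * (K * X) := by
      refine hN2.trans ?_
      gcongr
      refine (Real.rpow_le_rpow_of_exponent_le hKX ?_).trans (Real.rpow_one _).le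
      rw [div_le_one (by linarith)]
      exact hd'
    refine (Real.logb_le_logb_of_le (by norm_num) (by linarith) h1).trans ?_
    rw [Real.logb_mul (by norm_num) (by positivity), Real.logb_mul (by positivity) (by positivity),
      Real.logb_self_eq_one (by norm_num)]
    linarith
  set m := L * Λ * ℓ with hm
  have hlogq : Real.logb 2 (2 * (q : ℝ) + 1) ≤
      (Real.logb 2 (6 * A) + 3 * Real.logb 2 Q + 3 + 6 * r + r * Real.logb 2 K) * m := by
    have h1 : 2 * (q : ℝ) + 1 ≤ 6 * A * (Q * Y) ^ (L + 2) * (N : ℝ) ^ r := by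
      calc 2 * (q : ℝ) + 1 ≤ 6 * P := by linarith
        _ = _ := by rw [hP]; ring
    refine (Real.logb_le_logb_of_le (by norm_num) (by positivity) h1).trans ?_
    rw [Real.logb_mul (by positivity) (by positivity),
      Real.logb_mul (b := 2) (x := 6 * A) (by positivity) (by positivity), Real.logb_pow,
      Real.logb_mul (x := Q) (by positivity) (by positivity),
      Real.logb_rpow_eq_mul_logb_of_pos (by linarith),
      ← hldef]
    push_cast
    have e1 : Real.logb 2 (6 * A) ≤ Real.logb 2 (6 * A) * m := le_mul_of_one_le_right hlogA hm1
    have e2 : ((L : ℝ) + 2) * (Real.logb 2 Q + ℓ) ≤ 3 * Real.logb 2 Q * m + 3 * m := by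
      have : ((L : ℝ) + 2) * (Real.logb 2 Q + ℓ) ≤ (3 * L) * (Real.logb 2 Q + ℓ) := by
        gcongr
        linarith
      have : L * Real.logb 2 Q ≤ m * Real.logb 2 Q := by gcongr
      nlinarith
    have e3 : r * Real.logb 2 N ≤ 6 * r * m + r * Real.logb 2 K * m := by
      have h5 : Real.logb 2 K ≤ Real.logb 2 K * m := le_mul_of_one_le_right hlogK hm1
      calc r * Real.logb 2 N ≤ r * (6 * m + Real.logb 2 K * m) := by
            gcongr
            linarith
        _ = _ := by ring
    linarith
  refine ⟨N, q, Nat.ceil_pos.2 (by linarith), Nat.ceil_pos.2 (by linarith), hN2, hq1, ?_⟩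
  have hbase : (2 * (q : ℝ) + 1) = 2 ^ Real.logb 2 (2 * (q : ℝ) + 1) :=
    (Real.rpow_logb (by norm_num) (by norm_num) (by positivity)).symm
  rw [hbase, ← Real.rpow_mul_natCast (by norm_num)]
  apply Real.rpow_lt_rpow_of_exponent_lt (by norm_num)
  set T := Real.logb 2 (6 * A) + 3 * Real.logb 2 Q + 3 + 6 * r + r * Real.logb 2 K with hT
  have f1 : Real.logb 2 (2 * (q : ℝ) + 1) * n ≤ T * m * n := by gcongr
  have f2 : 4 * T * (n * m) < K * (n * m) := by gcongr
  have f3 : K * (n * m) ≤ K * X := by gcongr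
  linarith

lemma isClosed_cube (d : ℕ) : IsClosed (cube d) := by
  rw [cube, Set.ofPred_forall]
  exact isClosed_iInter fun i => isClosed_le (by fun_prop) continuous_const

lemma volume_cube_lt_top (d : ℕ) : volume (cube d) < ⊤ := by
  refine Bornology.IsBounded.measure_lt_top
    ((Metric.isBounded_closedBall (x := 0) (r := √d)).subset fun x hx => ?_)
  rw [mem_closedBall_zero_iff, EuclideanSpace.norm_eq]
  apply Real.sqrt_le_sqrt
  calc ∑ i, ‖x i‖ ^ 2 ≤ ∑ _i : Fin d, (1 : ℝ) :=
        Finset.sum_le_sum fun i _ => pow_le_one₀ (norm_nonneg _) (hx i)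
    _ = d := by simp

/-- On a finite measure space the `L¹` norm is controlled by the `Lᵖ` norm. -/
lemma exists_lintegral_enorm_le_mul_eLpNorm {α : Type*} [MeasurableSpace α] (μ : Measure α)
    [IsFiniteMeasure μ] {p : ℝ≥0∞} (hp : 1 ≤ p) :
    ∃ W : ℝ, 0 < W ∧ ∀ f : α → ℝ, AEStronglyMeasurable f μ →
      ∫⁻ x, ‖f x‖ₑ ∂μ ≤ eLpNorm f p μ * ENNReal.ofReal W := by
  have he : 0 ≤ 1 / (1 : ℝ≥0∞).toReal - 1 / p.toReal := by
    rcases eq_or_ne p ⊤ with rfl | hp'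
    · simp
    · have : 1 ≤ p.toReal := by simpa using ENNReal.toReal_mono hp' hp
      simpa using inv_le_one_of_one_le₀ this
  have htop : μ Set.univ ^ (1 / (1 : ℝ≥0∞).toReal - 1 / p.toReal) ≠ ⊤ :=
    ENNReal.rpow_ne_top_of_nonneg he (measure_ne_top μ _)
  refine ⟨(μ Set.univ ^ (1 / (1 : ℝ≥0∞).toReal - 1 / p.toReal)).toReal + 1, by positivity,
    fun f hf => ?_⟩
  rw [← eLpNorm_one_eq_lintegral_enorm]
  refine (eLpNorm_le_eLpNorm_mul_rpow_measure_univ hp hf).trans ?_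
  gcongr
  exact (ENNReal.ofReal_toReal htop).symm.le.trans (ENNReal.ofReal_le_ofReal (by linarith))

/-- the `L^p` version of the lower bound of Theorem 2 of the paper,
`1 ≤ p ≤ ∞` : `dist(Lip^{(r,c₀)}, H_{n,L,σ,R}, L^p(𝕀^d)) ≥ C [L² n log₂ n log₂(R D_max)]^{-r/d}`
with `C > 0` depending only on `c`, `c₀`, `c₁`, `d`, `r` and `p` (it follows from the
`L¹` bound via `‖f‖_{L¹(𝕀^d)} ≤ C_{d,p} ‖f‖_{L^p(𝕀^d)}`).
(The lower bound on the sup-inf distance is expressed by: for every `C'` below the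
claimed bound there is `f ∈ Lip^{(r,c₀)}` whose `L^p`-distance to every member of the
class is at least `C'`.) -/
theorem stmt14 (d s : ℕ) (hd : 1 ≤ d) (v c0 c c1 r : ℝ) (hv : 0 < v) (hv1 : v ≤ 1)
    (hc0 : 0 < c0) (hc : 1 ≤ c) (hc1 : 1 ≤ c1) (hr : r = s + v)
    (p : ℝ≥0∞) (hp : 1 ≤ p) :
    ∃ C : ℝ, 0 < C ∧
      ∀ (L n : ℕ), 1 ≤ L → 2 ≤ n → ∀ R : ℝ, 1 ≤ R →
        ∀ σ : ℕ → ℝ → ℝ,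
          (∀ k, 1 ≤ k → k ≤ L → ∀ t t' : ℝ, |σ k t - σ k t'| ≤ c1 * |t - t'|) →
          (∀ k, 1 ≤ k → k ≤ L → ∀ t : ℝ, |σ k t| ≤ c * (|t| + 1)) →
          ∀ dims : ℕ → ℕ,
            2 ≤ R * (((Finset.range (L + 1)).sup (dimAt d dims) : ℕ) : ℝ) →
            ∀ S : NetStructure n L d dims,
              ∀ C' : ℝ,
                C' < C * ((L : ℝ) ^ 2 * (n : ℝ) * Real.logb 2 (n : ℝ) *
                      Real.logb 2
                        (R * (((Finset.range (L + 1)).sup (dimAt d dims) : ℕ) : ℝ))) ^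
                    (-(r / d)) →
                ∃ f ∈ LipClass d s v c0, ∀ h ∈ netClass S σ R,
                  ENNReal.ofReal C' ≤
                    eLpNorm (fun x => f x - h x) p (volume.restrict (cube d)) := by
  classical
  have hrpos : 0 < r := by rw [hr]; positivity
  have hfin : IsFiniteMeasure (volume.restrict (cube d)) :=
    ⟨by simpa using volume_cube_lt_top d⟩
  obtain ⟨κ, φ, hκ, hφ1, hφ0, hφLip⟩ := exists_bump_profile d s hv hv1 hc0
  obtain ⟨W, hW, hWle⟩ := exists_lintegral_enorm_le_mul_eLpNorm (volume.restrict (cube d)) hp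
  have hω : 0 < volume.real (Metric.ball (0 : EuclideanSpace ℝ (Fin d)) 1) :=
    ENNReal.toReal_pos (Metric.measure_ball_pos _ _ one_pos).ne' measure_ball_lt_top.ne
  set ω := volume.real (Metric.ball (0 : EuclideanSpace ℝ (Fin d)) 1) with hωdef
  set β : ℝ := κ * ω / (16 * 4 ^ d) with hβdef
  have hβ : 0 < β := by positivity
  have hQ0 : 1 ≤ 3 * c * c1 := by nlinarith
  obtain ⟨K, hK1, hK⟩ := exists_resolution hd (A := volume.real (cube d) / β + 1)
    (Q := 3 * c * c1) (r := r) (by simp only [le_add_iff_nonneg_left]; positivity) hQ0 hrpos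
  refine ⟨β / W * (2 ^ (-r) * K ^ (-(r / d))), by positivity, ?_⟩
  intro L n hL hn R hR σ hσ1 hσ dims hRD S C' hC'
  set Dn := (Finset.range (L + 1)).sup (dimAt d dims) with hDn
  have hdim : ∀ k ≤ L, (dimAt d dims k : ℝ) ≤ (Dn : ℝ) := by
    intro k hk
    exact_mod_cast Finset.le_sup (f := dimAt d dims) (Finset.mem_range.2 (by omega))
  have hD : (1 : ℝ) ≤ Dn := by
    refine le_trans ?_ (hdim 0 (by omega))
    exact_mod_cast hd
  obtain ⟨N, q, hN, hq, hNle, hqge, hcount⟩ := hK L n hL hn (R * Dn) hRD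
  have hN' : (0 : ℝ) < N := by exact_mod_cast hN
  have hq' : (0 : ℝ) < q := by exact_mod_cast hq
  set X := (L : ℝ) ^ 2 * n * Real.logb 2 n * Real.logb 2 (R * Dn) with hX
  have hX0 : 0 ≤ X := by
    have h1 : 0 ≤ Real.logb 2 n :=
      Real.logb_nonneg (by norm_num) (by exact_mod_cast (by omega : 1 ≤ n))
    have h2 : 0 ≤ Real.logb 2 (R * Dn) := Real.logb_nonneg (by norm_num) (by linarith)
    positivity
  have hσc : ∀ k, 1 ≤ k → k ≤ L → Continuous (σ k) := fun k h1 h2 =>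
    (LipschitzWith.of_dist_le_mul (K := ⟨c1, by linarith⟩) fun t t' => by
      rw [Real.dist_eq, Real.dist_eq]
      exact hσ1 k h1 h2 t t').continuous
  let H : (Fin n → Finset.Icc (-(q : ℤ)) q) → EuclideanSpace ℝ (Fin d) → ℝ :=
    fun m => S.eval σ fun i => R * ((m i : ℤ) : ℝ) / q
  have hHc : ∀ m, Continuous (H m) := fun m => S.continuous_eval hσc _
  have hcard : (Fintype.card (Fin n → Finset.Icc (-(q : ℤ)) q) : ℝ) < 2 ^ ((N : ℝ) ^ d / 4) := by
    refine lt_of_eq_of_lt ?_ hcount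
    have : ((q : ℤ) + 1 + (q : ℤ)).toNat = 2 * q + 1 := by omega
    simp [this]
  obtain ⟨ε, hε, hfar⟩ := exists_signs_far hφ1 hφ0 (a := κ * (N : ℝ) ^ (-(s + v))) (by positivity)
    hN hcard fun m => (hHc m).measurable
  have hfLip := hφLip N hN _ _ (fun _ _ => one_le_dist_halfLattice) ε hε
  set f : EuclideanSpace ℝ (Fin d) → ℝ := fun x =>
    ∑ j, (κ * (N : ℝ) ^ (-(s + v)) * ε j) * φ ((N : ℝ) • x - halfLattice j) with hf
  refine ⟨f, hfLip, fun h hh => ?_⟩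
  obtain ⟨m, hm⟩ := exists_grid_net S hc hc1 hR hD hdim hσ1 hσ hq hh
  have hhc : Continuous h := by
    obtain ⟨θ, -, rfl⟩ := hh
    exact S.continuous_eval hσc θ
  set δ := β * (N : ℝ) ^ (-r) with hδ
  have hδ0 : 0 < δ := by positivity
  have hfar' : ENNReal.ofReal (δ + δ) ≤ ∫⁻ x in cube d, ‖f x - H m x‖ₑ := by
    refine le_trans (ENNReal.ofReal_le_ofReal (le_of_eq ?_)) (hfar m)
    rw [hδ, hβdef, hr, ← hωdef]
    field_simp
    norm_num
  have hnear : ∫⁻ x in cube d, ‖h x - H m x‖ₑ ≤ ENNReal.ofReal δ := by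
    calc ∫⁻ x in cube d, ‖h x - H m x‖ₑ
        ≤ ∫⁻ _x in cube d, ENNReal.ofReal ((3 * c * c1 * (R * Dn)) ^ (L + 2) / q) := by
          refine setLIntegral_mono' (isClosed_cube d).measurableSet fun x hx => ?_
          rw [Real.enorm_eq_ofReal_abs]
          exact ENNReal.ofReal_le_ofReal (hm x hx)
      _ = ENNReal.ofReal ((3 * c * c1 * (R * Dn)) ^ (L + 2) / q * volume.real (cube d)) := by
          rw [setLIntegral_const, ENNReal.ofReal_mul (by positivity), Measure.real,
            ENNReal.ofReal_toReal (volume_cube_lt_top d).ne]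
      _ ≤ ENNReal.ofReal δ := by
          apply ENNReal.ofReal_le_ofReal
          rw [div_mul_eq_mul_div, div_le_iff₀ hq']
          set P := (3 * c * c1 * (R * Dn)) ^ (L + 2) with hP
          have hNN : (N : ℝ) ^ (-r) * (N : ℝ) ^ r = 1 := by
            rw [← Real.rpow_add hN', neg_add_cancel, Real.rpow_zero]
          calc P * volume.real (cube d)
              ≤ P * volume.real (cube d) + β * P := le_add_of_nonneg_right (by positivity)
            _ = β * ((volume.real (cube d) / β + 1) * P) := by field_simp
            _ = β * ((volume.real (cube d) / β + 1) * P) * ((N : ℝ) ^ (-r) * (N : ℝ) ^ r) := by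
                rw [hNN, mul_one]
            _ = δ * ((volume.real (cube d) / β + 1) * P * (N : ℝ) ^ r) := by rw [hδ]; ring
            _ ≤ δ * q := by gcongr
  have htri : ∫⁻ x in cube d, ‖f x - H m x‖ₑ ≤
      (∫⁻ x in cube d, ‖f x - h x‖ₑ) + ∫⁻ x in cube d, ‖h x - H m x‖ₑ := by
    have hmeas : Measurable fun x => ‖h x - H m x‖ₑ := (hhc.sub (hHc m)).measurable.enorm
    rw [← lintegral_add_right _ hmeas]
    refine lintegral_mono fun x => ?_
    calc ‖f x - H m x‖ₑ = ‖(f x - h x) + (h x - H m x)‖ₑ := by rw [sub_add_sub_cancel]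
      _ ≤ _ := enorm_add_le _ _
  have hL1 : ENNReal.ofReal δ ≤ ∫⁻ x in cube d, ‖f x - h x‖ₑ := by
    have h1 := (hfar'.trans htri).trans (add_le_add_right hnear _)
    rw [ENNReal.ofReal_add hδ0.le hδ0.le] at h1
    exact (ENNReal.add_le_add_iff_right ENNReal.ofReal_ne_top).1 h1
  have hLp := hL1.trans (hWle (fun x => f x - h x)
    (hfLip.1.continuous.sub hhc).aestronglyMeasurable)
  have hfinal : ENNReal.ofReal (δ / W) ≤ eLpNorm (fun x => f x - h x) p
      (volume.restrict (cube d)) := by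
    rw [ENNReal.ofReal_div_of_pos hW]
    exact ENNReal.div_le_of_le_mul hLp
  refine le_trans (ENNReal.ofReal_le_ofReal (hC'.le.trans ?_)) hfinal
  clear_value X
  have hNr : 2 ^ (-r) * K ^ (-(r / d)) * X ^ (-(r / d)) ≤ (N : ℝ) ^ (-r) := by
    calc (2 : ℝ) ^ (-r) * K ^ (-(r / d)) * X ^ (-(r / d))
        = (2 * (K * X) ^ (1 / (d : ℝ))) ^ (-r) := by
          have hKX : 0 ≤ K * X := mul_nonneg (by linarith) hX0
          rw [Real.mul_rpow (x := 2) (by norm_num) (by positivity), ← Real.rpow_mul hKX,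
            Real.mul_rpow (x := K) (y := X) (by linarith) hX0,
            show 1 / (d : ℝ) * -r = -(r / d) by ring]
          ring
      _ ≤ (N : ℝ) ^ (-r) := Real.rpow_le_rpow_of_nonpos hN' hNle (by linarith)
  calc β / W * (2 ^ (-r) * K ^ (-(r / d))) * X ^ (-(r / d))
      = β / W * (2 ^ (-r) * K ^ (-(r / d)) * X ^ (-(r / d))) := by ring
    _ ≤ β / W * (N : ℝ) ^ (-r) := by gcongr
    _ = δ / W := by rw [hδ]; ring

end
end
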